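/- The map 𝔥 : Y → X defined by 𝔥(λ,x,y) = (λ,x) is a homeomorphism from Y onto X, with inverse given by (λ,x) ↦ (λ, x, φ(λ, x(·), x'(·))); moreover 𝔥 respects triviality: (λ,x,y) ∈ Y is a trivial T-triple (i.e. λ = 0 and (x,y) is constant) if and only if (λ,x) is a trivial T-forced pair (i.e. λ = 0 and x is constant). -/

import Mathlib

open Set MeasureTheory intervalIntegral BoundedContinuousFunction

/-- `f : ℝ × U × ℝⁿ × [0,∞) → ℝⁿ` is a `T`-periodic Carathéodory map. -/
def TPeriodicCaratheodory (n : ℕ) (U : Set (EuclideanSpace ℝ (Fin n))) (T : ℝ)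
    (f : ℝ → EuclideanSpace ℝ (Fin n) → EuclideanSpace ℝ (Fin n) → ℝ →
      EuclideanSpace ℝ (Fin n)) : Prop :=
  (∀ p ∈ U, ∀ q : EuclideanSpace ℝ (Fin n), ∀ lam ∈ Set.Ici (0:ℝ),
      ∀ᵐ t : ℝ, f (t + T) p q lam = f t p q lam) ∧
  (∀ p ∈ U, ∀ q : EuclideanSpace ℝ (Fin n), ∀ lam ∈ Set.Ici (0:ℝ),
      Measurable fun t : ℝ => f t p q lam) ∧
  (∀ᵐ t : ℝ, ContinuousOn
      (fun z : EuclideanSpace ℝ (Fin n) × EuclideanSpace ℝ (Fin n) × ℝ =>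
        f t z.1 z.2.1 z.2.2)
      (U ×ˢ Set.univ ×ˢ Set.Ici 0)) ∧
  (∀ K : Set (EuclideanSpace ℝ (Fin n) × EuclideanSpace ℝ (Fin n) × ℝ),
      K ⊆ U ×ˢ Set.univ ×ˢ Set.Ici 0 → IsCompact K →
      ∃ σ : ℝ → ℝ, (∀ t, 0 ≤ σ t) ∧ (∀ t, σ (t + T) = σ t) ∧
        MeasureTheory.LocallyIntegrable σ ∧
        ∀ᵐ t : ℝ, ∀ z ∈ K, ‖f t z.1 z.2.1 z.2.2‖ ≤ σ t)

/-- The set `Y` of `T`-triples `(λ, x, y)` of the system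
`x' = ψ(λ,x,y)`, `y' = λ f(t,x,ψ(λ,x,y),λ)`, as a subset of
`ℝ × (ℝ →ᵇ ℝⁿ) × (ℝ →ᵇ ℝⁿ)` (the sup-metric encodes the `C⁰` topology on `[0,T]`,
by `T`-periodicity). -/
def TripleSet (n : ℕ) (U : Set (EuclideanSpace ℝ (Fin n)))
    (ψ : ℝ → EuclideanSpace ℝ (Fin n) → EuclideanSpace ℝ (Fin n) →
      EuclideanSpace ℝ (Fin n))
    (T : ℝ)
    (f : ℝ → EuclideanSpace ℝ (Fin n) → EuclideanSpace ℝ (Fin n) → ℝ →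
      EuclideanSpace ℝ (Fin n)) :
    Set (ℝ × (ℝ →ᵇ EuclideanSpace ℝ (Fin n)) × (ℝ →ᵇ EuclideanSpace ℝ (Fin n))) :=
  {z | 0 ≤ z.1 ∧ (∀ t : ℝ, z.2.1 t ∈ U) ∧
    (∀ t : ℝ, z.2.1 (t + T) = z.2.1 t) ∧ (∀ t : ℝ, z.2.2 (t + T) = z.2.2 t) ∧
    (∀ t : ℝ, z.2.1 t = z.2.1 0 + ∫ s in (0:ℝ)..t, ψ z.1 (z.2.1 s) (z.2.2 s)) ∧
    (∀ t : ℝ, z.2.2 t = z.2.2 0 +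
      z.1 • ∫ s in (0:ℝ)..t, f s (z.2.1 s) (ψ z.1 (z.2.1 s) (z.2.2 s)) z.1)}

/-- The set `X` of `T`-forced pairs of `[φ(λ,x,x')]' = λ f(t,x,x',λ)`, encoded as triples
`(λ, x, x')` in `ℝ × (ℝ →ᵇ ℝⁿ) × (ℝ →ᵇ ℝⁿ)` where `x'` is the derivative of `x`
(the sup-metrics on `x` and `x'` encode the `C¹` topology on `[0,T]`, by periodicity). -/
def ForcedSet (n : ℕ) (U : Set (EuclideanSpace ℝ (Fin n)))
    (φ : ℝ → EuclideanSpace ℝ (Fin n) → EuclideanSpace ℝ (Fin n) →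
      EuclideanSpace ℝ (Fin n))
    (T : ℝ)
    (f : ℝ → EuclideanSpace ℝ (Fin n) → EuclideanSpace ℝ (Fin n) → ℝ →
      EuclideanSpace ℝ (Fin n)) :
    Set (ℝ × (ℝ →ᵇ EuclideanSpace ℝ (Fin n)) × (ℝ →ᵇ EuclideanSpace ℝ (Fin n))) :=
  {w | 0 ≤ w.1 ∧ (∀ t : ℝ, w.2.1 t ∈ U) ∧
    (∀ t : ℝ, w.2.1 (t + T) = w.2.1 t) ∧ (∀ t : ℝ, w.2.2 (t + T) = w.2.2 t) ∧
    (∀ t : ℝ, HasDerivAt w.2.1 (w.2.2 t) t) ∧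
    (∀ t : ℝ, φ w.1 (w.2.1 t) (w.2.2 t) = φ w.1 (w.2.1 0) (w.2.2 0) +
      w.1 • ∫ s in (0:ℝ)..t, f s (w.2.1 s) (w.2.2 s) w.1)}

/-- The triples `(λ, x, y)` with `λ ≥ 0`, where `x` and `y` are `T`-periodic curves and `x` takes
values in `U`. -/
def PeriodicTriples {E : Type*} [NormedAddCommGroup E] (U : Set E) (T : ℝ) :
    Set (ℝ × (ℝ →ᵇ E) × (ℝ →ᵇ E)) :=
  {z | 0 ≤ z.1 ∧ (∀ t : ℝ, z.2.1 t ∈ U) ∧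
    (∀ t : ℝ, z.2.1 (t + T) = z.2.1 t) ∧ (∀ t : ℝ, z.2.2 (t + T) = z.2.2 t)}

namespace PeriodicTriples

variable {E : Type*} [NormedAddCommGroup E] {U : Set E} {T : ℝ}

/-- The curve `t ↦ (λ, x t, y t)` in the domain `[0,∞) × U × E`. -/
def curve (z : PeriodicTriples U T) (t : ℝ) : (Set.Ici (0 : ℝ) ×ˢ U ×ˢ (Set.univ : Set E) : Set _) :=
  ⟨(z.1.1, z.1.2.1 t, z.1.2.2 t), z.2.1, z.2.2.1 t, Set.mem_univ _⟩

lemma continuous_curve (z : PeriodicTriples U T) : Continuous (curve z) :=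
  (continuous_const.prodMk (z.1.2.1.continuous.prodMk z.1.2.2.continuous)).subtype_mk _

lemma periodic_curve (z : PeriodicTriples U T) : Function.Periodic (curve z) T := fun t =>
  Subtype.ext (Prod.ext rfl (Prod.ext (z.2.2.2.1 t) (z.2.2.2.2 t)))

lemma dist_curve_le (z w : PeriodicTriples U T) (t : ℝ) : dist (curve z t) (curve w t) ≤ dist z w :=
  max_le_max le_rfl
    (max_le_max (BoundedContinuousFunction.dist_coe_le_dist t)
      (BoundedContinuousFunction.dist_coe_le_dist t))

lemma isCompact_range_curve (hT : T ≠ 0) (z : PeriodicTriples U T) :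
    IsCompact (Set.range (curve z)) :=
  (periodic_curve z).compact_of_continuous hT (continuous_curve z)

variable {g : ℝ → E → E → E}

/-- The bounded continuous function `t ↦ g λ (x t) (y t)`. -/
def superposition (hT : T ≠ 0)
    (hg : ContinuousOn (fun z : ℝ × E × E => g z.1 z.2.1 z.2.2) (Set.Ici 0 ×ˢ U ×ˢ Set.univ))
    (z : PeriodicTriples U T) : ℝ →ᵇ E where
  toFun t := g z.1.1 (z.1.2.1 t) (z.1.2.2 t)
  continuous_toFun := hg.domRestrict.comp (continuous_curve z)
  map_bounded' := by
    have h := ((isCompact_range_curve hT z).image hg.domRestrict).isBounded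
    rw [← Set.range_comp] at h
    exact Metric.isBounded_range_iff.1 h

lemma continuous_superposition (hT : T ≠ 0)
    (hg : ContinuousOn (fun z : ℝ × E × E => g z.1 z.2.1 z.2.2) (Set.Ici 0 ×ˢ U ×ˢ Set.univ)) :
    Continuous (superposition (T := T) hT hg) := by
  rw [Metric.continuous_iff]
  intro z ε hε
  have h := (isCompact_range_curve hT z).uniformContinuousAt_of_continuousAt _
    (fun a _ => hg.domRestrict.continuousAt) (Metric.dist_mem_uniformity (half_pos hε))
  obtain ⟨δ, hδ, hsub⟩ := Metric.mem_uniformity_dist.1 h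
  refine ⟨δ, hδ, fun w hw => ?_⟩
  refine lt_of_le_of_lt ((BoundedContinuousFunction.dist_le (half_pos hε).le).2 fun t => ?_)
    (half_lt_self hε)
  rw [dist_comm]
  have hlt : dist (curve z t) (curve w t) < δ :=
    (dist_curve_le z w t).trans_lt (by rwa [dist_comm])
  exact (hsub hlt ⟨t, rfl⟩).le

end PeriodicTriples

open PeriodicTriples

lemma TripleSet.subset_periodicTriples {n : ℕ} {U : Set (EuclideanSpace ℝ (Fin n))}
    {ψ : ℝ → EuclideanSpace ℝ (Fin n) → EuclideanSpace ℝ (Fin n) → EuclideanSpace ℝ (Fin n)}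
    {T : ℝ}
    {f : ℝ → EuclideanSpace ℝ (Fin n) → EuclideanSpace ℝ (Fin n) → ℝ →
      EuclideanSpace ℝ (Fin n)} :
    TripleSet n U ψ T f ⊆ PeriodicTriples U T :=
  fun _ h => ⟨h.1, h.2.1, h.2.2.1, h.2.2.2.1⟩

lemma ForcedSet.subset_periodicTriples {n : ℕ} {U : Set (EuclideanSpace ℝ (Fin n))}
    {φ : ℝ → EuclideanSpace ℝ (Fin n) → EuclideanSpace ℝ (Fin n) → EuclideanSpace ℝ (Fin n)}
    {T : ℝ}
    {f : ℝ → EuclideanSpace ℝ (Fin n) → EuclideanSpace ℝ (Fin n) → ℝ →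
      EuclideanSpace ℝ (Fin n)} :
    ForcedSet n U φ T f ⊆ PeriodicTriples U T :=
  fun _ h => ⟨h.1, h.2.1, h.2.2.1, h.2.2.2.1⟩

lemma mem_forcedSet_of_mem_tripleSet {n : ℕ} {U : Set (EuclideanSpace ℝ (Fin n))}
    {φ ψ : ℝ → EuclideanSpace ℝ (Fin n) → EuclideanSpace ℝ (Fin n) → EuclideanSpace ℝ (Fin n)}
    {T : ℝ}
    {f : ℝ → EuclideanSpace ℝ (Fin n) → EuclideanSpace ℝ (Fin n) → ℝ →
      EuclideanSpace ℝ (Fin n)}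
    (hφψ : ∀ lam ∈ Set.Ici (0 : ℝ), ∀ p ∈ U, ∀ u, φ lam p (ψ lam p u) = u)
    {lam : ℝ} {x y v : ℝ →ᵇ EuclideanSpace ℝ (Fin n)}
    (h : (lam, x, y) ∈ TripleSet n U ψ T f) (hv : ∀ t, v t = ψ lam (x t) (y t)) :
    (lam, x, v) ∈ ForcedSet n U φ T f := by
  obtain ⟨h0, hU, hx, hy, hxi, hyi⟩ := h
  dsimp only at h0 hU hx hy hxi hyi
  simp only [← hv] at hxi hyi
  have hφv : ∀ t, φ lam (x t) (v t) = y t := fun t => by rw [hv, hφψ lam h0 _ (hU t)]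
  refine ⟨h0, hU, hx, fun t => ?_, fun t => ?_, fun t => ?_⟩
  · simp only [hv, hx, hy]
  · have hd := (v.continuous.integral_hasStrictDerivAt 0 t).hasDerivAt.const_add (x 0)
    exact hd.congr_of_eventuallyEq (Filter.Eventually.of_forall hxi)
  · simp only [hφv]
    exact hyi t

lemma mem_tripleSet_of_mem_forcedSet {n : ℕ} {U : Set (EuclideanSpace ℝ (Fin n))}
    {φ ψ : ℝ → EuclideanSpace ℝ (Fin n) → EuclideanSpace ℝ (Fin n) → EuclideanSpace ℝ (Fin n)}
    {T : ℝ}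
    {f : ℝ → EuclideanSpace ℝ (Fin n) → EuclideanSpace ℝ (Fin n) → ℝ →
      EuclideanSpace ℝ (Fin n)}
    (hψφ : ∀ lam ∈ Set.Ici (0 : ℝ), ∀ p ∈ U, ∀ q, ψ lam p (φ lam p q) = q)
    {lam : ℝ} {x v y : ℝ →ᵇ EuclideanSpace ℝ (Fin n)}
    (h : (lam, x, v) ∈ ForcedSet n U φ T f) (hy : ∀ t, y t = φ lam (x t) (v t)) :
    (lam, x, y) ∈ TripleSet n U ψ T f := by
  obtain ⟨h0, hU, hx, hv, hd, hi⟩ := h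
  dsimp only at h0 hU hx hv hd hi
  simp only [← hy] at hi
  have hψy : ∀ t, ψ lam (x t) (y t) = v t := fun t => by rw [hy, hψφ lam h0 _ (hU t)]
  refine ⟨h0, hU, hx, fun t => ?_, fun t => ?_, fun t => ?_⟩
  · simp only [hy, hx, hv]
  · simp only [hψy]
    rw [intervalIntegral.integral_eq_sub_of_hasDerivAt (fun s _ => hd s)
      (v.continuous.intervalIntegrable 0 t), add_sub_cancel]
  · simp only [hψy]
    exact hi t

/-- Lemma 5.1: the map `𝔥 : (λ,x,y) ↦ (λ,x)` is a homeomorphism from the set of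
`T`-triples of the equivalent system onto the set of `T`-forced pairs of
`[φ(λ,x,x')]' = λ f(t,x,x',λ)` (with the `C¹` topology on the latter), its inverse being
`(λ,x) ↦ (λ,x,φ(λ,x,x'))`, and it respects triviality. -/
theorem stmt_6 (n : ℕ) (hn : 1 ≤ n)
    (U : Set (EuclideanSpace ℝ (Fin n))) (hU : IsOpen U)
    (φ ψ : ℝ → EuclideanSpace ℝ (Fin n) → EuclideanSpace ℝ (Fin n) →
      EuclideanSpace ℝ (Fin n))
    (hφcont : ContinuousOn
      (fun z : ℝ × EuclideanSpace ℝ (Fin n) × EuclideanSpace ℝ (Fin n) =>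
        φ z.1 z.2.1 z.2.2)
      (Set.Ici 0 ×ˢ U ×ˢ Set.univ))
    (hφbij : ∀ lam ∈ Set.Ici (0:ℝ), ∀ p ∈ U, Function.Bijective (φ lam p))
    (hψspec : ∀ lam ∈ Set.Ici (0:ℝ), ∀ p ∈ U, ∀ u : EuclideanSpace ℝ (Fin n),
      φ lam p (ψ lam p u) = u)
    (hψcont : ContinuousOn
      (fun z : ℝ × EuclideanSpace ℝ (Fin n) × EuclideanSpace ℝ (Fin n) =>
        ψ z.1 z.2.1 z.2.2)
      (Set.Ici 0 ×ˢ U ×ˢ Set.univ))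
    (T : ℝ) (hT : 0 < T)
    (f : ℝ → EuclideanSpace ℝ (Fin n) → EuclideanSpace ℝ (Fin n) → ℝ →
      EuclideanSpace ℝ (Fin n))
    (hf : TPeriodicCaratheodory n U T f) :
    ∃ H : (TripleSet n U ψ T f) ≃ₜ (ForcedSet n U φ T f),
      -- `𝔥(λ,x,y) = (λ,x)`
      (∀ z : TripleSet n U ψ T f,
        (H z).1.1 = z.1.1 ∧ (H z).1.2.1 = z.1.2.1) ∧
      -- the inverse is `(λ,x) ↦ (λ, x, φ(λ, x(·), x'(·)))`
      (∀ w : ForcedSet n U φ T f, ∀ t : ℝ,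
        (H.symm w).1.2.2 t = φ w.1.1 (w.1.2.1 t) (w.1.2.2 t)) ∧
      -- `𝔥` respects triviality
      (∀ z : TripleSet n U ψ T f,
        (z.1.1 = 0 ∧ (∀ t : ℝ, z.1.2.1 t = z.1.2.1 0) ∧
          (∀ t : ℝ, z.1.2.2 t = z.1.2.2 0)) ↔
        ((H z).1.1 = 0 ∧ ∀ t : ℝ, (H z).1.2.1 t = (H z).1.2.1 0)) := by
  have hψφ : ∀ lam ∈ Set.Ici (0 : ℝ), ∀ p ∈ U, ∀ q, ψ lam p (φ lam p q) = q :=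
    fun lam hlam p hp q => (hφbij lam hlam p hp).1 (hψspec lam hlam p hp _)
  let ι : TripleSet n U ψ T f → PeriodicTriples U T :=
    Set.inclusion TripleSet.subset_periodicTriples
  let κ : ForcedSet n U φ T f → PeriodicTriples U T :=
    Set.inclusion ForcedSet.subset_periodicTriples
  have hι : Continuous ι := continuous_inclusion _
  have hκ : Continuous κ := continuous_inclusion _
  let H : TripleSet n U ψ T f ≃ₜ ForcedSet n U φ T f :=
    { toFun := fun z => ⟨(z.1.1, z.1.2.1, superposition hT.ne' hψcont (ι z)),
        mem_forcedSet_of_mem_tripleSet hψspec z.2 fun _ => rfl⟩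
      invFun := fun w => ⟨(w.1.1, w.1.2.1, superposition hT.ne' hφcont (κ w)),
        mem_tripleSet_of_mem_forcedSet hψφ w.2 fun _ => rfl⟩
      left_inv := fun z => Subtype.ext <| Prod.ext rfl <| Prod.ext rfl <|
        BoundedContinuousFunction.ext fun t => hψspec _ z.2.1 _ (z.2.2.1 t) _
      right_inv := fun w => Subtype.ext <| Prod.ext rfl <| Prod.ext rfl <|
        BoundedContinuousFunction.ext fun t => hψφ _ w.2.1 _ (w.2.2.1 t) _
      continuous_toFun := (continuous_subtype_val.fst.prodMk
        (continuous_subtype_val.snd.fst.prodMk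
          ((continuous_superposition hT.ne' hψcont).comp hι))).subtype_mk _
      continuous_invFun := (continuous_subtype_val.fst.prodMk
        (continuous_subtype_val.snd.fst.prodMk
          ((continuous_superposition hT.ne' hφcont).comp hκ))).subtype_mk _ }
  refine ⟨H, fun z => ⟨rfl, rfl⟩, fun w t => rfl, fun z =>
    ⟨fun h => ⟨h.1, h.2.1⟩, fun h => ⟨h.1, h.2, fun t => ?_⟩⟩⟩
  have h0 : z.1.1 = 0 := h.1
  have hy := z.2.2.2.2.2.2 t
  rwa [h0, zero_smul, add_zero] at hy
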